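/- (Theorem 2, part (ii).) In the example instance, ℛ_a* strictly contains ℛ_a: the rate tuple (0, 0, 0, 3 + H_b(1/4) − H*({1,2,3,4})) belongs to ℛ_a* but not to ℛ_a. -/

import Mathlib

open scoped Classical

noncomputable section

/-- A probability mass function on a finite type: nonnegative and summing to one. -/
def IsPMF {α : Type*} [Fintype α] (p : α → ℝ) : Prop :=
  (∀ x, 0 ≤ p x) ∧ ∑ x, p x = 1

/-- Shannon entropy in bits, with the convention `0 · log₂ 0 = 0`. -/
def Ent {α : Type*} [Fintype α] (p : α → ℝ) : ℝ :=
  -∑ x, p x * Real.logb 2 (p x)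

/-- Pushforward of a mass function along a map. -/
def push {α β : Type*} [Fintype α] (f : α → β) (p : α → ℝ) : β → ℝ :=
  fun b => ∑ a ∈ Finset.univ.filter (fun a => f a = b), p a

/-- Tuples indexed by a finite subset `A` of the coordinates. -/
abbrev Vec {N : ℕ} (X : Fin N → Type) (A : Finset (Fin N)) : Type :=
  ∀ i : {i // i ∈ A}, X i.1

section

variable {N : ℕ} {X : Fin N → Type} [∀ i, Fintype (X i)]

/-- Restriction of a tuple on coordinates `A` to a smaller subset `B ⊆ A`. -/
def restr {A B : Finset (Fin N)} (h : B ⊆ A) (x : Vec X A) : Vec X B :=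
  fun i => x ⟨i.1, h i.2⟩

/-- Marginal of a mass function on coordinates `A` onto `B ⊆ A`. -/
def marg {A B : Finset (Fin N)} (p : Vec X A → ℝ) (h : B ⊆ A) : Vec X B → ℝ :=
  push (restr h) p

/-- Marginal of a mass function on all coordinates onto the subset `A`. -/
def margF (p : (∀ i, X i) → ℝ) (A : Finset (Fin N)) : Vec X A → ℝ :=
  push (fun x i => x i.1) p

/-- Single-coordinate marginal. -/
def margOne (p : (∀ i, X i) → ℝ) (i : Fin N) : X i → ℝ :=
  push (fun x => x i) p

variable {M : ℕ}

/-- The prescribed subset distributions are PMFs, consistent with each other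
(marginals agree on intersections) and with the single-coordinate marginals `P i`. -/
def Consistent (P : ∀ i, X i → ℝ) (S : Fin M → Finset (Fin N))
    (PS : ∀ j, Vec X (S j) → ℝ) : Prop :=
  (∀ i, IsPMF (P i)) ∧ (∀ j, IsPMF (PS j)) ∧
  (∀ j j', marg (PS j) (Finset.inter_subset_left : S j ∩ S j' ⊆ S j)
         = marg (PS j') (Finset.inter_subset_right : S j ∩ S j' ⊆ S j')) ∧
  (∀ j, ∀ i, ∀ h : i ∈ S j, push (fun x : Vec X (S j) => x ⟨i, h⟩) (PS j) = P i)

/-- The constrained maximum entropy `H*(𝒥)`: the supremum of entropies of PMFs on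
`∏_{i ∈ 𝒥} 𝒳_i` whose marginal on `𝒥 ∩ 𝒮_j` equals the marginal of `P_{𝒮_j}` for every `j`. -/
def Hstar (S : Fin M → Finset (Fin N)) (PS : ∀ j, Vec X (S j) → ℝ)
    (J : Finset (Fin N)) : ℝ :=
  sSup { h | ∃ q : Vec X J → ℝ, IsPMF q ∧
    (∀ j, marg q (Finset.inter_subset_left : J ∩ S j ⊆ J)
        = marg (PS j) (Finset.inter_subset_right : J ∩ S j ⊆ S j)) ∧
    h = Ent q }

end

/-- `ε`-typicality of a length-`n` sequence for a PMF `Q`. -/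
def Typical {α : Type*} [Fintype α] (n : ℕ) (ε : ℝ) (Q : α → ℝ) (x : Fin n → α) : Prop :=
  ∀ a, |((Finset.univ.filter (fun l => x l = a)).card : ℝ) / n - Q a| ≤ ε * Q a

/-- Joint `ε`-typicality, for the tuple of sequences restricted to the subset `A`,
of the induced sequence over the product alphabet. -/
def SubTyp {N : ℕ} {X : Fin N → Type} [∀ i, Fintype (X i)] (n : ℕ) (ε : ℝ)
    {A : Finset (Fin N)} (Q : Vec X A → ℝ) (x : ∀ i, Fin n → X i) : Prop :=
  Typical n ε Q (fun l (i : {i // i ∈ A}) => x i.1 l)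

/-- Probability of the event `E` when the `N` sequences of length `n` are generated
mutually independently, coordinatewise i.i.d. according to the marginals `P i`. -/
def probIID {N : ℕ} {X : Fin N → Type} [∀ i, Fintype (X i)] (P : ∀ i, X i → ℝ) (n : ℕ)
    (E : (∀ i, Fin n → X i) → Prop) : ℝ :=
  ∑ x ∈ Finset.univ.filter E, ∏ i, ∏ l, P i (x i l)

/-- `δ` is a valid correction function: positive on positive arguments and
vanishing as `ε → 0⁺`. -/
def DeltaFun (δ : ℝ → ℝ) : Prop :=
  (∀ ε, 0 < ε → 0 < δ ε) ∧ Filter.Tendsto δ (nhdsWithin 0 (Set.Ioi 0)) (nhds 0)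

end
noncomputable section

/-- The rate region `ℛ_a`: the closed convex hull of rate tuples achievable with a single
joint distribution consistent with all the prescribed subset distributions. -/
def Ra {N M : ℕ} {X : Fin N → Type} [∀ i, Fintype (X i)] (P : ∀ i, X i → ℝ)
    (S : Fin M → Finset (Fin N)) (PS : ∀ j, Vec X (S j) → ℝ) : Set (Fin N → ℝ) :=
  closure (convexHull ℝ
    { R | ∃ p : (∀ i, X i) → ℝ, IsPMF p ∧ (∀ j, margF p (S j) = PS j) ∧
        ∀ J : Finset (Fin N), J.Nonempty →
          ∑ i ∈ J, R i ≥ (∑ i ∈ J, Ent (P i)) - Ent (margF p J) })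

/-- The rate region `ℛ_a*` given by the constrained maximum entropy functionals. -/
def RaStar {N M : ℕ} {X : Fin N → Type} [∀ i, Fintype (X i)] (P : ∀ i, X i → ℝ)
    (S : Fin M → Finset (Fin N)) (PS : ∀ j, Vec X (S j) → ℝ) : Set (Fin N → ℝ) :=
  { R | ∀ J : Finset (Fin N), J.Nonempty →
      ∑ i ∈ J, R i ≥ (∑ i ∈ J, Ent (P i)) - Hstar S PS J }

end
noncomputable section

/-- The six two-element constraint subsets of the example instance
(coordinates `0,1,2,3` standing for `X₁,X₂,X₃,X₄`). -/
def Spairs : Fin 6 → Finset (Fin 4) := ![{0, 1}, {0, 2}, {1, 2}, {0, 3}, {1, 3}, {2, 3}]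

/-- The marginal PMFs of the example: `X₁,X₂,X₃ ~ bern(1/2)`, `X₄ ~ bern(3/4)`
(with `false` standing for `0`). -/
def Pex : ∀ _ : Fin 4, Bool → ℝ :=
  fun i b => if i.1 < 3 then 1 / 2 else if b = false then 3 / 4 else 1 / 4

/-- The prescribed pairwise PMF of `(Xᵢ, X₄)`: mass `1/2` at `(0,0)`, `0` at `(0,1)`,
`1/4` at `(1,0)` and `1/4` at `(1,1)`. -/
def pair14 : Bool → Bool → ℝ :=
  fun a b => if a = false then (if b = false then 1 / 2 else 0) else 1 / 4

/-- Value of a tuple `y` on subset `A` at a coordinate `i` (junk value `false` if `i ∉ A`). -/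
def getB {A : Finset (Fin 4)} (y : Vec (fun _ : Fin 4 => Bool) A) (i : Fin 4) : Bool :=
  if h : i ∈ A then y ⟨i, h⟩ else false

/-- The prescribed pairwise distributions of the example instance: `(Xᵢ, Xⱼ)` is uniform on
`{0,1}²` for `i < j` in `{1,2,3}`, and `(Xᵢ, X₄)` is distributed according to `pair14`. -/
def PSex (j : Fin 6) : Vec (fun _ : Fin 4 => Bool) (Spairs j) → ℝ :=
  fun y =>
    if j.1 < 3 then 1 / 4
    else pair14 (getB y ⟨j.1 - 3, by have := j.isLt; omega⟩) (getB y 3)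

/-- Binary entropy function (in bits). -/
def Hb (p : ℝ) : ℝ := -(p * Real.logb 2 p) - (1 - p) * Real.logb 2 (1 - p)

end

/-- Marginalizing twice is marginalizing along the composition. -/
theorem push_push {α β γ : Type*} [Fintype α] [Fintype β] (g : β → γ) (f : α → β) (p : α → ℝ) :
    push g (push f p) = push (fun a => g (f a)) p := by
  funext c
  simp only [push, Finset.sum_filter]
  simp_rw [Finset.sum_ite, Finset.sum_const_zero, add_zero, Finset.sum_filter]
  rw [← Finset.sum_filter, Finset.sum_comm]
  refine Finset.sum_congr rfl fun a _ => ?_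
  simp [Finset.sum_ite_eq]

theorem push_apply_of_injective {α β : Type*} [Fintype α] {f : α → β} (hf : Function.Injective f)
    (p : α → ℝ) (a : α) : push f p (f a) = p a := by
  simp [push, Finset.sum_filter, hf.eq_iff]

theorem push_const {α β : Type*} [Fintype α] [DecidableEq β] (f : α → β) (c : ℝ) (b : β) :
    push f (fun _ => c) b = ((Finset.univ.filter fun a => f a = b).card : ℝ) * c := by
  simp only [push, Finset.sum_const, nsmul_eq_mul]
  congr!

theorem IsPMF.push {α β : Type*} [Fintype α] [Fintype β] {p : α → ℝ} (hp : IsPMF p) (f : α → β) :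
    IsPMF (push f p) := by
  refine ⟨fun b => Finset.sum_nonneg fun a _ => hp.1 a, ?_⟩
  rw [← hp.2]
  exact Finset.sum_fiberwise Finset.univ f p

theorem Ent_le_card_div_log_two {α : Type*} [Fintype α] {p : α → ℝ} (hp : IsPMF p) :
    Ent p ≤ Fintype.card α / Real.log 2 := by
  have hlog : 0 < Real.log 2 := Real.log_pos one_lt_two
  have h (x : α) : -(p x * Real.logb 2 (p x)) ≤ 1 / Real.log 2 := by
    rw [Real.logb, ← mul_div_assoc, ← neg_div]
    gcongr
    rcases (hp.1 x).eq_or_lt with h0 | h0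
    · simp [← h0]
    · have h1 := mul_le_mul_of_nonneg_left (Real.one_sub_inv_le_log_of_pos h0) h0.le
      rw [mul_sub, mul_inv_cancel₀ h0.ne'] at h1
      linarith
  calc Ent p = ∑ x, -(p x * Real.logb 2 (p x)) := by rw [Ent, Finset.sum_neg_distrib]
    _ ≤ ∑ _x : α, 1 / Real.log 2 := Finset.sum_le_sum fun x _ => h x
    _ = Fintype.card α / Real.log 2 := by simp [div_eq_mul_inv]

/-- A mass function bounded by `2⁻ᵏ` has at least `k` bits of entropy. -/
theorem le_Ent_of_mul_two_pow_le {α : Type*} [Fintype α] {p : α → ℝ} (hp : IsPMF p) (k : ℕ)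
    (h : ∀ x, p x * 2 ^ k ≤ 1) : (k : ℝ) ≤ Ent p := by
  have hx (x : α) : p x * k ≤ -(p x * Real.logb 2 (p x)) := by
    rcases (hp.1 x).eq_or_lt with h0 | h0
    · simp [← h0]
    · have h1 : Real.logb 2 (p x * 2 ^ k) ≤ 0 :=
        Real.logb_nonpos one_lt_two (by positivity) (h x)
      rw [Real.logb_mul h0.ne' (by positivity), Real.logb_pow, Real.logb_self_eq_one one_lt_two]
        at h1
      nlinarith
  calc (k : ℝ) = ∑ x, p x * k := by rw [← Finset.sum_mul, hp.2, one_mul]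
    _ ≤ ∑ x, -(p x * Real.logb 2 (p x)) := Finset.sum_le_sum fun x _ => hx x
    _ = Ent p := by rw [Ent, Finset.sum_neg_distrib]

theorem logb_two_one_div_four : Real.logb 2 (1 / 4) = -2 := by
  rw [show (1 / 4 : ℝ) = 2 ^ (-2 : ℝ) by norm_num [Real.rpow_neg]]
  exact Real.logb_rpow two_pos one_lt_two.ne'

theorem Ent_eq_two {α : Type*} [Fintype α] {p : α → ℝ} (hp : IsPMF p)
    (h : ∀ x, p x = 0 ∨ p x = 1 / 4) : Ent p = 2 := by
  have hx (x : α) : p x * Real.logb 2 (p x) = p x * -2 := by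
    rcases h x with h0 | h0
    · simp [h0]
    · rw [h0, logb_two_one_div_four]
  rw [Ent, Finset.sum_congr rfl fun x _ => hx x, ← Finset.sum_mul, hp.2]
  norm_num

theorem le_Hstar {N M : ℕ} {X : Fin N → Type} [∀ i, Fintype (X i)] {S : Fin M → Finset (Fin N)}
    {PS : ∀ j, Vec X (S j) → ℝ} {J : Finset (Fin N)} {q : Vec X J → ℝ} (hq : IsPMF q)
    (h : ∀ j, marg q (Finset.inter_subset_left : J ∩ S j ⊆ J)
        = marg (PS j) (Finset.inter_subset_right : J ∩ S j ⊆ S j)) :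
    Ent q ≤ Hstar S PS J := by
  refine le_csSup ⟨Fintype.card (Vec X J) / Real.log 2, ?_⟩ ⟨q, hq, h, rfl⟩
  rintro _ ⟨q', hq', -, rfl⟩
  exact Ent_le_card_div_log_two hq'

/-- The support map of the only joint distribution consistent with the example constraints. -/
def exampleTuple (s : Bool × Bool) : Fin 4 → Bool :=
  ![s.1, s.2, s.1 == s.2, s.1 && s.2]

/-- The only joint distribution consistent with the example constraints: the law of
`exampleTuple` of two fair bits. -/
noncomputable def exampleJoint : (Fin 4 → Bool) → ℝ :=
  push exampleTuple fun _ => 1 / 4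

theorem isPMF_exampleJoint : IsPMF exampleJoint :=
  IsPMF.push ⟨fun _ => by norm_num, by simp⟩ _

theorem margF_exampleJoint (A : Finset (Fin 4)) (y : Vec (fun _ : Fin 4 => Bool) A) :
    margF exampleJoint A y =
      ((Finset.univ.filter fun s => (fun i : {i // i ∈ A} => exampleTuple s i.1) = y).card : ℝ)
        * (1 / 4) := by
  rw [margF, exampleJoint, push_push, push_const]

theorem margF_exampleJoint_Spairs (j : Fin 6) : margF exampleJoint (Spairs j) = PSex j := by
  funext y
  rw [margF_exampleJoint]
  have h : ∀ (j : Fin 6) (y : Vec (fun _ : Fin 4 => Bool) (Spairs j)),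
      (Finset.univ.filter fun s =>
        (fun i : {i // i ∈ Spairs j} => exampleTuple s i.1) = y).card =
      if j.1 < 3 then 1
      else if getB y ⟨j.1 - 3, by have := j.isLt; omega⟩ = false then
        if getB y 3 = false then 2 else 0
      else 1 := by
    decide
  rw [h]
  simp only [PSex, pair14]
  split_ifs <;> norm_num

theorem sum_fin_four_bool (f : (Fin 4 → Bool) → ℝ) :
    ∑ x, f x = ∑ a, ∑ b, ∑ c, ∑ d, f ![a, b, c, d] := by
  let e : Bool × Bool × Bool × Bool ≃ (Fin 4 → Bool) :=
    { toFun := fun s => ![s.1, s.2.1, s.2.2.1, s.2.2.2]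
      invFun := fun x => (x 0, x 1, x 2, x 3)
      left_inv := fun _ => rfl
      right_inv := fun x => by funext i; fin_cases i <;> rfl }
  rw [← e.sum_comp]
  simp only [Fintype.sum_prod_type]
  rfl

theorem eq_exampleJoint {p : (Fin 4 → Bool) → ℝ} (hp : IsPMF p)
    (h : ∀ j, margF p (Spairs j) = margF exampleJoint (Spairs j)) : p = exampleJoint := by
  have pair (j : Fin 6) (i k : Fin 4) (hi : i ∈ Spairs j) (hk : k ∈ Spairs j) (a b : Bool) :
      ∑ x, (if x i = a ∧ x k = b then p x else 0) =
        ∑ s, (if exampleTuple s i = a ∧ exampleTuple s k = b then 1 / 4 else 0) := by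
    have h1 := congrArg (push fun y => (y ⟨i, hi⟩, y ⟨k, hk⟩)) (h j)
    rw [margF, margF, exampleJoint, push_push, push_push, push_push] at h1
    have h2 := congrFun h1 (a, b)
    simpa only [push, Finset.sum_filter, Prod.mk.injEq] using h2
  have h01 := pair 0 0 1 (by decide) (by decide)
  have h02 := pair 1 0 2 (by decide) (by decide)
  have h12 := pair 2 1 2 (by decide) (by decide)
  have h03 := pair 3 0 3 (by decide) (by decide)
  have h13 := pair 4 1 3 (by decide) (by decide)
  have h23 := pair 5 2 3 (by decide) (by decide)
  simp [sum_fin_four_bool, Fintype.sum_prod_type, exampleTuple] at h01 h02 h12 h03 h13 h23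
  have hx (a b c d : Bool) : p ![a, b, c, d] = exampleJoint ![a, b, c, d] := by
    have hr : exampleJoint ![a, b, c, d] =
        if c = (a == b) ∧ d = (a && b) then 1 / 4 else 0 := by
      rw [exampleJoint, push_const]
      have : ∀ a b c d : Bool, (Finset.univ.filter fun s => exampleTuple s = ![a, b, c, d]).card =
          if c = (a == b) ∧ d = (a && b) then 1 else 0 := by decide
      rw [this]
      split_ifs <;> norm_num
    rw [hr]
    have h0 (a b c d : Bool) := hp.1 ![a, b, c, d]
    simp only [Bool.forall_bool] at h0
    casesm* _ ∧ _
    cases a <;> cases b <;> cases c <;> cases d <;> simp <;> linarith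
  funext x
  have := hx (x 0) (x 1) (x 2) (x 3)
  rwa [show ![x 0, x 1, x 2, x 3] = x by funext i; fin_cases i <;> rfl] at this

theorem Hstar_univ_le_two : Hstar Spairs PSex Finset.univ ≤ 2 := by
  refine Real.sSup_le ?_ zero_le_two
  rintro _ ⟨q, hq, h, rfl⟩
  let e : Vec (fun _ : Fin 4 => Bool) Finset.univ → Fin 4 → Bool :=
    fun y i => y ⟨i, Finset.mem_univ i⟩
  have he : Function.Injective e := fun y z hyz => funext fun i => congrFun hyz i.1
  have hp : push e q = exampleJoint := by
    refine eq_exampleJoint (hq.push e) fun j => ?_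
    have h1 := congrArg (push fun (y : Vec (fun _ : Fin 4 => Bool) (Finset.univ ∩ Spairs j))
      (i : {i // i ∈ Spairs j}) => y ⟨i.1, by simp [i.2]⟩) (h j)
    rw [← margF_exampleJoint_Spairs] at h1
    simp only [marg, margF, push_push] at h1 ⊢
    exact h1
  refine (Ent_eq_two hq fun y => ?_).le
  rw [← push_apply_of_injective he q y, hp, exampleJoint, push_const]
  have hc : ∀ x, (Finset.univ.filter fun s => exampleTuple s = x).card = 0 ∨
      (Finset.univ.filter fun s => exampleTuple s = x).card = 1 := by decide
  rcases hc (e y) with h1 | h1 <;> simp [h1]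

theorem Ent_margF_exampleJoint_zero_one_two : Ent (margF exampleJoint {0, 1, 2}) = 2 := by
  refine Ent_eq_two (isPMF_exampleJoint.push _) fun y => ?_
  rw [margF_exampleJoint]
  have hc : ∀ y : Vec (fun _ : Fin 4 => Bool) {0, 1, 2},
      (Finset.univ.filter fun s =>
        (fun i : {i // i ∈ ({0, 1, 2} : Finset (Fin 4))} => exampleTuple s i.1) = y).card = 0 ∨
      (Finset.univ.filter fun s =>
        (fun i : {i // i ∈ ({0, 1, 2} : Finset (Fin 4))} => exampleTuple s i.1) = y).card = 1 := by
    decide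
  rcases hc y with h1 | h1 <;> simp [h1]

theorem Ent_margF_exampleJoint_le_Hstar (J : Finset (Fin 4)) :
    Ent (margF exampleJoint J) ≤ Hstar Spairs PSex J := by
  refine le_Hstar (isPMF_exampleJoint.push _) fun j => ?_
  rw [← margF_exampleJoint_Spairs]
  simp only [marg, margF, push_push]
  rfl

theorem le_Hstar_of_card_mul_le (J : Finset (Fin 4)) (k : ℕ)
    (h : ∀ t, (Finset.univ.filter fun s => ∀ i ∈ J, exampleTuple s i = exampleTuple t i).card
      * 2 ^ k ≤ 4) : (k : ℝ) ≤ Hstar Spairs PSex J := by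
  refine (le_Ent_of_mul_two_pow_le (isPMF_exampleJoint.push _) k fun y => ?_).trans
    (Ent_margF_exampleJoint_le_Hstar J)
  change margF exampleJoint J y * 2 ^ k ≤ 1
  rw [margF_exampleJoint]
  rcases Finset.eq_empty_or_nonempty
    (Finset.univ.filter fun s => (fun i : {i // i ∈ J} => exampleTuple s i.1) = y) with h0 | ⟨t, ht⟩
  · simp [h0]
  · obtain rfl := (Finset.mem_filter.1 ht).2
    have h1 : ((Finset.univ.filter fun s => ∀ i ∈ J, exampleTuple s i = exampleTuple t i).card : ℝ)
      * 2 ^ k ≤ 4 := by exact_mod_cast h t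
    simp only [funext_iff, Subtype.forall]
    linarith

theorem card_le_Hstar {J : Finset (Fin 4)} (h3 : 3 ∉ J) : (J.card : ℝ) ≤ Hstar Spairs PSex J := by
  by_cases hJ : J = {0, 1, 2}
  · subst hJ
    let f : Bool × Bool × Bool → Vec (fun _ : Fin 4 => Bool) {0, 1, 2} :=
      fun s i => ![s.1, s.2.1, s.2.2, false] i.1
    have hu : IsPMF fun _ : Bool × Bool × Bool => (1 / 8 : ℝ) :=
      ⟨fun _ => by norm_num, by simp⟩
    refine (le_Ent_of_mul_two_pow_le (hu.push f) 3 fun y => ?_).trans (le_Hstar (hu.push f) ?_)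
    · have hc : ∀ y, (Finset.univ.filter fun s => f s = y).card ≤ 1 := by decide
      have hc' : ((Finset.univ.filter fun s => f s = y).card : ℝ) ≤ 1 := by exact_mod_cast hc y
      rw [push_const]
      linarith
    · intro j
      rw [← margF_exampleJoint_Spairs]
      simp only [marg, margF, exampleJoint, push_push]
      funext y
      rw [push_const, push_const]
      have hc : ∀ (j : Fin 6) (y : Vec (fun _ : Fin 4 => Bool) ({0, 1, 2} ∩ Spairs j)),
          (Finset.univ.filter fun s => restr Finset.inter_subset_left (f s) = y).card =
          2 * (Finset.univ.filter fun s => (restr Finset.inter_subset_right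
            (fun i : {i // i ∈ Spairs j} => exampleTuple s i.1)) = y).card := by
        decide
      rw [hc]
      push_cast
      ring
  · refine le_Hstar_of_card_mul_le J _ ?_
    revert J
    decide

theorem card_le_Hstar_add_two {J : Finset (Fin 4)} (hJ : J ≠ Finset.univ) :
    (J.card : ℝ) ≤ Hstar Spairs PSex J + 2 := by
  have h : ((J.card - 2 : ℕ) : ℝ) ≤ Hstar Spairs PSex J := by
    refine le_Hstar_of_card_mul_le J _ ?_
    revert J
    decide
  have : (J.card : ℝ) ≤ ((J.card - 2 : ℕ) : ℝ) + 2 := by norm_cast; omega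
  linarith

theorem Ent_Pex (i : Fin 4) : Ent (Pex i) = 1 + if i = 3 then Hb (1 / 4) - 1 else 0 := by
  fin_cases i <;> simp [Ent, Pex, Hb]
  norm_num
  ring

theorem sum_Ent_Pex (J : Finset (Fin 4)) :
    ∑ i ∈ J, Ent (Pex i) = J.card + if 3 ∈ J then Hb (1 / 4) - 1 else 0 := by
  simp [Ent_Pex, Finset.sum_add_distrib]

theorem sum_vec_zero_zero_zero (J : Finset (Fin 4)) (r : ℝ) :
    ∑ i ∈ J, ![0, 0, 0, r] i = if 3 ∈ J then r else 0 := by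
  have h (i : Fin 4) : ![0, 0, 0, r] i = if i = 3 then r else 0 := by fin_cases i <;> simp
  simp [h]

theorem one_le_sum_of_mem_Ra {R : Fin 4 → ℝ}
    (hR : R ∈ Ra (X := fun _ : Fin 4 => Bool) Pex Spairs PSex) :
    1 ≤ ∑ i ∈ ({0, 1, 2} : Finset (Fin 4)), R i := by
  let f : (Fin 4 → ℝ) →ₗ[ℝ] ℝ := ∑ i ∈ ({0, 1, 2} : Finset (Fin 4)), LinearMap.proj i
  have hf (R : Fin 4 → ℝ) : f R = ∑ i ∈ ({0, 1, 2} : Finset (Fin 4)), R i := by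
    simp [f]
  have hclosed : IsClosed {R : Fin 4 → ℝ | 1 ≤ f R} := by
    simp only [hf]
    exact isClosed_le (by fun_prop) (by fun_prop)
  have hsub := closure_minimal (convexHull_min ?_ (convex_halfSpace_ge f.isLinear 1)) hclosed hR
  · simpa only [Set.mem_ofPred_eq, hf] using hsub
  · rintro R ⟨p, hp, hpS, hpJ⟩
    have hpe : p = exampleJoint :=
      eq_exampleJoint hp fun j => (hpS j).trans (margF_exampleJoint_Spairs j).symm
    have h1 := hpJ {0, 1, 2} (by simp)
    rw [hpe, Ent_margF_exampleJoint_zero_one_two, sum_Ent_Pex] at h1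
    rw [Set.mem_ofPred_eq, hf]
    rw [if_neg (by decide), show (({0, 1, 2} : Finset (Fin 4)).card : ℝ) = 3 by rfl] at h1
    linarith

theorem RaStar_strictly_larger_example :
    (![0, 0, 0, 3 + Hb (1 / 4) - Hstar Spairs PSex Finset.univ])
        ∈ RaStar (X := fun _ : Fin 4 => Bool) Pex Spairs PSex ∧
    (![0, 0, 0, 3 + Hb (1 / 4) - Hstar Spairs PSex Finset.univ])
        ∉ Ra (X := fun _ : Fin 4 => Bool) Pex Spairs PSex := by
  refine ⟨fun J _ => ?_, fun hR => ?_⟩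
  · rw [sum_vec_zero_zero_zero, sum_Ent_Pex]
    by_cases h3 : 3 ∈ J
    · rw [if_pos h3, if_pos h3]
      by_cases hJ : J = Finset.univ
      · subst hJ
        norm_num
        linarith
      · linarith [card_le_Hstar_add_two hJ, Hstar_univ_le_two]
    · rw [if_neg h3, if_neg h3]
      linarith [card_le_Hstar h3]
  · have h1 := one_le_sum_of_mem_Ra hR
    rw [sum_vec_zero_zero_zero, if_neg (by decide)] at h1
    linarith
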